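/- Let S be a semigroup with only finitely many H-classes. Then the following are equivalent: (1) S is completely separable; (2) every Schützenberger group of S is completely separable; (3) S is finite. -/

import Mathlib

open scoped Pointwise

/-- A semigroup is residually finite if distinct points can be distinguished in a
finite semigroup quotient (image). -/
def IsResiduallyFiniteSemigroup (S : Type*) [Semigroup S] : Prop :=
  ∀ s t : S, s ≠ t →
    ∃ (U : Type) (_ : Semigroup U) (_ : Finite U) (f : S →ₙ* U), f s ≠ f t

/-- A semigroup is weakly subsemigroup separable if every element outside a finitely
generated subsemigroup can be separated from it in a finite semigroup image. -/
def IsWeaklySubsemigroupSeparable (S : Type*) [Semigroup S] : Prop :=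
  ∀ T : Subsemigroup S, (∃ Y : Finset S, T = Subsemigroup.closure (Y : Set S)) →
    ∀ s : S, s ∉ T →
      ∃ (U : Type) (_ : Semigroup U) (_ : Finite U) (f : S →ₙ* U),
        f s ∉ f '' (T : Set S)

/-- A semigroup is strongly subsemigroup separable if every element outside a
subsemigroup can be separated from it in a finite semigroup image. -/
def IsStronglySubsemigroupSeparable (S : Type*) [Semigroup S] : Prop :=
  ∀ T : Subsemigroup S, ∀ s : S, s ∉ T →
    ∃ (U : Type) (_ : Semigroup U) (_ : Finite U) (f : S →ₙ* U),
      f s ∉ f '' (T : Set S)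

/-- A semigroup is completely separable if every element can be separated from its
complement in a finite semigroup image. -/
def IsCompletelySeparable (S : Type*) [Semigroup S] : Prop :=
  ∀ s : S,
    ∃ (U : Type) (_ : Semigroup U) (_ : Finite U) (f : S →ₙ* U),
      f s ∉ f '' {t : S | t ≠ s}

/-- A semigroup is locally finite if every finitely generated subsemigroup is finite. -/
def IsLocallyFiniteSemigroup (S : Type*) [Semigroup S] : Prop :=
  ∀ Y : Finset S, ((Subsemigroup.closure (Y : Set S) : Subsemigroup S) : Set S).Finite

/-- A group is weakly subgroup separable (LERF) if every element outside a finitely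
generated subgroup can be separated from it in a finite group image. -/
def IsWeaklySubgroupSeparable (G : Type*) [Group G] : Prop :=
  ∀ H : Subgroup G, H.FG → ∀ g : G, g ∉ H →
    ∃ (K : Type) (_ : Group K) (_ : Finite K) (f : G →* K),
      f g ∉ f '' (H : Set G)

/-- A group is strongly subgroup separable (ERF) if every element outside a subgroup
can be separated from it in a finite group image. -/
def IsStronglySubgroupSeparable (G : Type*) [Group G] : Prop :=
  ∀ H : Subgroup G, ∀ g : G, g ∉ H →
    ∃ (K : Type) (_ : Group K) (_ : Finite K) (f : G →* K),
      f g ∉ f '' (H : Set G)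

/-- Green's relation H: x H y iff xS¹ = yS¹ and S¹x = S¹y. -/
def GreenH {S : Type*} [Semigroup S] (x y : S) : Prop :=
  insert x {z : S | ∃ s : S, z = x * s} = insert y {z : S | ∃ s : S, z = y * s} ∧
  insert x {z : S | ∃ s : S, z = s * x} = insert y {z : S | ∃ s : S, z = s * y}

/-- The H-class of an element. -/
def HClass {S : Type*} [Semigroup S] (x : S) : Set S := {y : S | GreenH x y}

/-- The n-fold pointwise product A·A⋯A (for n ≥ 1; we set the value at 0 to be A). -/
def SetNPow {S : Type*} [Semigroup S] (A : Set S) : ℕ → Set S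
  | 0 => A
  | 1 => A
  | n + 2 => SetNPow A (n + 1) * A

/-- The right stabiliser Stab(H) = {s ∈ S¹ | Hs = H}, a submonoid of S¹ = WithOne S. -/
def SchStab {S : Type*} [Semigroup S] (H : Set S) : Submonoid (WithOne S) where
  carrier := {s : WithOne S |
    (fun h => h * s) '' ((fun x : S => (x : WithOne S)) '' H)
      = (fun x : S => (x : WithOne S)) '' H}
  one_mem' := by
    simp only [Set.mem_setOf_eq, mul_one, Set.image_id']
  mul_mem' := by
    intro a b ha hb
    simp only [Set.mem_setOf_eq] at ha hb ⊢
    have hcomp : (fun h : WithOne S => h * (a * b))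
        = (fun h : WithOne S => h * b) ∘ fun h : WithOne S => h * a := by
      funext h; simp [mul_assoc]
    rw [hcomp, Set.image_comp, ha, hb]

/-- `(Γ, φ)` realises the Schützenberger group of the H-class `H`: `φ` is a surjective
monoid homomorphism from `Stab(H)` onto the group `Γ` whose kernel relation is exactly
the Schützenberger congruence `σ_H`. -/
def IsSchutzenbergerGroup {S : Type*} [Semigroup S] (H : Set S) (Γ : Type*) [Group Γ]
    (φ : SchStab H →* Γ) : Prop :=
  Function.Surjective φ ∧
    ∀ a b : SchStab H,
      φ a = φ b ↔ ∀ h ∈ H,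
        (h : WithOne S) * (a : WithOne S) = (h : WithOne S) * (b : WithOne S)

section GreenRelation

variable {S : Type*} [Semigroup S]

theorem insert_right_multiples_eq (x : S) :
    insert x {z : S | ∃ s : S, z = x * s} = {z : S | ∃ s : WithOne S, (x : WithOne S) * s = z} := by
  ext z
  simp only [Set.mem_insert_iff, Set.mem_ofPred_eq]
  constructor
  · rintro (rfl | ⟨s, rfl⟩)
    · exact ⟨1, mul_one _⟩
    · exact ⟨s, rfl⟩
  · rintro ⟨s, hs⟩
    cases s with
    | one => exact Or.inl (WithOne.coe_inj.1 (by simpa using hs.symm))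
    | coe s => exact Or.inr ⟨s, WithOne.coe_inj.1 hs.symm⟩

theorem insert_left_multiples_eq (x : S) :
    insert x {z : S | ∃ s : S, z = s * x} = {z : S | ∃ s : WithOne S, s * (x : WithOne S) = z} := by
  ext z
  simp only [Set.mem_insert_iff, Set.mem_ofPred_eq]
  constructor
  · rintro (rfl | ⟨s, rfl⟩)
    · exact ⟨1, one_mul _⟩
    · exact ⟨s, rfl⟩
  · rintro ⟨s, hs⟩
    cases s with
    | one => exact Or.inl (WithOne.coe_inj.1 (by simpa using hs.symm))
    | coe s => exact Or.inr ⟨s, WithOne.coe_inj.1 hs.symm⟩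

theorem greenH_iff (x y : S) :
    GreenH x y ↔
      ((∃ s : WithOne S, (x : WithOne S) * s = y) ∧ ∃ s : WithOne S, (y : WithOne S) * s = x) ∧
      ((∃ s : WithOne S, s * (x : WithOne S) = y) ∧ ∃ s : WithOne S, s * (y : WithOne S) = x) := by
  simp only [GreenH, insert_right_multiples_eq, insert_left_multiples_eq]
  refine and_congr ⟨fun h => ⟨?_, ?_⟩, ?_⟩ ⟨fun h => ⟨?_, ?_⟩, ?_⟩
  · exact h.symm.subset ⟨1, mul_one _⟩
  · exact h.subset ⟨1, mul_one _⟩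
  · rintro ⟨⟨s, hs⟩, t, ht⟩
    ext z
    constructor
    · rintro ⟨r, hr⟩
      exact ⟨t * r, by rw [← mul_assoc, ht, hr]⟩
    · rintro ⟨r, hr⟩
      exact ⟨s * r, by rw [← mul_assoc, hs, hr]⟩
  · exact h.symm.subset ⟨1, one_mul _⟩
  · exact h.subset ⟨1, one_mul _⟩
  · rintro ⟨⟨s, hs⟩, t, ht⟩
    ext z
    constructor
    · rintro ⟨r, hr⟩
      exact ⟨r * t, by rw [mul_assoc, ht, hr]⟩
    · rintro ⟨r, hr⟩
      exact ⟨r * s, by rw [mul_assoc, hs, hr]⟩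

theorem GreenH.refl (x : S) : GreenH x x := ⟨rfl, rfl⟩

theorem GreenH.symm {x y : S} (h : GreenH x y) : GreenH y x := ⟨h.1.symm, h.2.symm⟩

theorem GreenH.trans {x y z : S} (h : GreenH x y) (h' : GreenH y z) : GreenH x z :=
  ⟨h.1.trans h'.1, h.2.trans h'.2⟩

theorem exists_coe_eq_coe_mul (x : S) (s : WithOne S) : ∃ z : S, (x : WithOne S) * s = z := by
  cases s with
  | one => exact ⟨x, mul_one _⟩
  | coe s => exact ⟨x * s, rfl⟩

/-- Right multiplication by `a` and fixing one point fixes everything in the same `H`-class. -/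
theorem GreenH.mul_eq_self {x y : S} (h : GreenH x y) {a : WithOne S}
    (ha : (x : WithOne S) * a = x) : (y : WithOne S) * a = y := by
  obtain ⟨-, ⟨u, hu⟩, -⟩ := (greenH_iff x y).1 h
  rw [← hu, mul_assoc, ha]

/-- Green's lemma: right multiplication carrying `x` to an `H`-equivalent element preserves
the `H`-class of `x`. -/
theorem GreenH.greenH_mul {x y z w : S} {s : WithOne S} (hxy : GreenH x y)
    (hs : (x : WithOne S) * s = y) (hxz : GreenH x z) (hw : (z : WithOne S) * s = w) :
    GreenH x w := by
  obtain ⟨⟨-, t, ht⟩, -⟩ := (greenH_iff x y).1 hxy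
  obtain ⟨-, ⟨u, hu⟩, v, hv⟩ := (greenH_iff x z).1 hxz
  have hzst : (z : WithOne S) * (s * t) = z :=
    hxz.mul_eq_self (by rw [← mul_assoc, hs, ht])
  have hzw : (insert z {r : S | ∃ s : S, r = z * s}) = insert w {r : S | ∃ s : S, r = w * s} := by
    simp only [insert_right_multiples_eq]
    ext r
    constructor
    · rintro ⟨c, hc⟩
      exact ⟨t * c, by rw [← hw, ← mul_assoc, mul_assoc (z : WithOne S), hzst, hc]⟩
    · rintro ⟨c, hc⟩
      exact ⟨s * c, by rw [← mul_assoc, hw, hc]⟩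
  have hyw : (insert y {r : S | ∃ s : S, r = s * y}) = insert w {r : S | ∃ s : S, r = s * w} := by
    simp only [insert_left_multiples_eq]
    ext r
    constructor
    · rintro ⟨c, hc⟩
      exact ⟨c * v, by rw [← hw, mul_assoc, ← mul_assoc v, hv, hs, hc]⟩
    · rintro ⟨c, hc⟩
      exact ⟨c * u, by rw [← hs, mul_assoc, ← mul_assoc u, hu, hw, hc]⟩
  exact ⟨hxz.1.trans hzw, hxy.2.trans hyw⟩

theorem finite_of_finite_hClasses (hfin : (Set.range fun x : S => HClass x).Finite)
    (h : ∀ x : S, (HClass x).Finite) : Finite S := by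
  rw [← Set.finite_univ_iff]
  refine (hfin.sUnion (by rintro _ ⟨x, rfl⟩; exact h x)).subset fun x _ => ?_
  exact ⟨HClass x, ⟨x, rfl⟩, GreenH.refl x⟩

end GreenRelation

section CompleteSeparability

variable {S : Type*} [Semigroup S]

theorem IsCompletelySeparable.finite_hClass (hS : IsCompletelySeparable S) (x : S) :
    (HClass x).Finite := by
  obtain ⟨U, _, _, f, hf⟩ := hS x
  refine Set.Finite.of_finite_image (Set.toFinite (f '' HClass x)) fun y hy z hz hyz => ?_
  obtain ⟨⟨⟨s, hs⟩, t, ht⟩, -⟩ := (greenH_iff x y).1 hy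
  obtain ⟨w, hw⟩ := exists_coe_eq_coe_mul z t
  have hfw : f w = f x := by
    have h1 := congrArg (WithOne.mapMulHom f) hw
    have h2 := congrArg (WithOne.mapMulHom f) ht
    simp only [map_mul, WithOne.mapMulHom_coe] at h1 h2
    rw [← hyz, h2] at h1
    exact WithOne.coe_inj.1 h1.symm
  have hwx : w = x := by
    by_contra hne
    exact hf ⟨w, hne, hfw⟩
  have hz' : (z : WithOne S) * (t * s) = z :=
    (hy.symm.trans hz).mul_eq_self (by rw [← mul_assoc, ht, hs])
  rw [← mul_assoc, hw, hwx, hs] at hz'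
  exact WithOne.coe_inj.1 hz'

theorem IsCompletelySeparable.of_finite [Finite S] : IsCompletelySeparable S := by
  intro s
  let e : Shrink.{0} S ≃* S := Shrink.mulEquiv
  refine ⟨Shrink.{0} S, inferInstance, Finite.of_equiv S e.symm.toEquiv, e.symm.toMulHom, ?_⟩
  rintro ⟨t, ht, hts⟩
  exact ht (e.symm.injective hts)

theorem IsCompletelySeparable.finite_of_group {G : Type*} [Group G]
    (hG : IsCompletelySeparable G) : Finite G := by
  obtain ⟨U, _, _, f, hf⟩ := hG 1
  refine Finite.of_injective f fun a b hab => ?_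
  by_contra hne
  refine hf ⟨a⁻¹ * b, fun h => hne (inv_mul_eq_one.1 h), ?_⟩
  rw [map_mul, ← hab, ← map_mul, inv_mul_cancel]

end CompleteSeparability

section SchutzenbergerGroup

variable {S : Type*} [Semigroup S]

theorem exists_mul_coe_eq_of_mem_schStab {H : Set S} (a : SchStab H) {h : S} (hh : h ∈ H) :
    ∃ k ∈ H, (h : WithOne S) * (a : WithOne S) = k := by
  have : (h : WithOne S) * (a : WithOne S) ∈ (fun x : S => (x : WithOne S)) '' H :=
    a.2.subset ⟨h, ⟨h, hh, rfl⟩, rfl⟩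
  obtain ⟨k, hk, hk'⟩ := this
  exact ⟨k, hk, hk'.symm⟩

/-- The Schützenberger congruence on the right stabiliser of `H`. -/
def schCon (H : Set S) : Con (SchStab H) where
  r a b := ∀ h ∈ H, (h : WithOne S) * (a : WithOne S) = (h : WithOne S) * (b : WithOne S)
  iseqv := ⟨fun _ _ _ => rfl, fun h k hk => (h k hk).symm,
    fun h h' k hk => (h k hk).trans (h' k hk)⟩
  mul' := by
    intro a b c d hab hcd h hh
    obtain ⟨k, hk, hbk⟩ := exists_mul_coe_eq_of_mem_schStab b hh
    simp only [Submonoid.coe_mul]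
    rw [← mul_assoc, hab h hh, hbk, hcd k hk, ← hbk, mul_assoc]

theorem mem_schStab_of_mul_eq {x y : S} {s : WithOne S} (hxy : GreenH x y)
    (hs : (x : WithOne S) * s = y) : s ∈ SchStab (HClass x) := by
  obtain ⟨⟨-, t, ht⟩, -⟩ := (greenH_iff x y).1 hxy
  apply Set.Subset.antisymm
  · rintro _ ⟨_, ⟨z, hz, rfl⟩, rfl⟩
    obtain ⟨w, hw⟩ := exists_coe_eq_coe_mul z s
    exact ⟨w, hxy.greenH_mul hs hz hw, hw.symm⟩
  · rintro _ ⟨z, hz, rfl⟩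
    obtain ⟨w, hw⟩ := exists_coe_eq_coe_mul z t
    refine ⟨w, ⟨w, hxy.trans (hxy.symm.greenH_mul ht (hxy.symm.trans hz) hw), rfl⟩, ?_⟩
    have hts : (y : WithOne S) * (t * s) = y := by rw [← mul_assoc, ht, hs]
    change (w : WithOne S) * s = z
    rw [← hw, mul_assoc]
    exact (hxy.symm.trans hz).mul_eq_self hts

theorem exists_schCon_mul_eq_one {x : S} (a : SchStab (HClass x)) :
    ∃ b : SchStab (HClass x), schCon (HClass x) (a * b) 1 := by
  obtain ⟨y, hy, hay⟩ := exists_mul_coe_eq_of_mem_schStab a (GreenH.refl x : x ∈ HClass x)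
  obtain ⟨⟨-, t, ht⟩, -⟩ := (greenH_iff x y).1 hy
  have hxa : (x : WithOne S) * ((a : WithOne S) * t) = x := by rw [← mul_assoc, hay, ht]
  have hmem : t ∈ SchStab (HClass x) := by
    have h := mem_schStab_of_mul_eq hy.symm ht
    have hH : HClass y = HClass x :=
      Set.ext fun z => ⟨fun hz => GreenH.trans hy hz, fun hz => GreenH.trans (GreenH.symm hy) hz⟩
    rwa [hH] at h
  refine ⟨⟨t, hmem⟩, fun h hh => ?_⟩
  simpa using GreenH.mul_eq_self hh hxa

theorem isUnit_schCon_quotient {x : S} (q : (schCon (HClass x)).Quotient) : IsUnit q := by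
  have hinv : ∀ q : (schCon (HClass x)).Quotient, ∃ r, q * r = 1 := by
    intro q
    obtain ⟨a, rfl⟩ := Con.mk'_surjective q
    obtain ⟨b, hb⟩ := exists_schCon_mul_eq_one a
    exact ⟨b, (Con.eq _).2 hb⟩
  obtain ⟨r, hr⟩ := hinv q
  obtain ⟨p, hp⟩ := hinv r
  exact ⟨⟨q, r, hr, by rwa [left_inv_eq_right_inv hr hp]⟩, rfl⟩

/-- The Schützenberger group of the `H`-class of `x`. -/
@[reducible]
noncomputable def schGroup (x : S) : Group (schCon (HClass x)).Quotient :=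
  groupOfIsUnit isUnit_schCon_quotient

theorem isSchutzenbergerGroup_mk' (x : S) :
    letI := schGroup x
    IsSchutzenbergerGroup (HClass x) (schCon (HClass x)).Quotient (schCon (HClass x)).mk' :=
  ⟨Con.mk'_surjective, fun _ _ => Con.eq _⟩

theorem IsSchutzenbergerGroup.finite_hClass {x : S} {Γ : Type*} [Group Γ] [Finite Γ]
    {φ : SchStab (HClass x) →* Γ} (hφ : IsSchutzenbergerGroup (HClass x) Γ φ) :
    (HClass x).Finite := by
  have hx : x ∈ HClass x := GreenH.refl x
  have hex : ∀ y : HClass x, ∃ a : SchStab (HClass x), (x : WithOne S) * (a : WithOne S) = y.1 := by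
    rintro ⟨y, hy⟩
    obtain ⟨⟨⟨s, hs⟩, -⟩, -⟩ := (greenH_iff x y).1 hy
    exact ⟨⟨s, mem_schStab_of_mul_eq hy hs⟩, hs⟩
  choose a ha using hex
  refine Set.finite_coe_iff.1 (Finite.of_injective (fun y => φ (a y)) fun y z hyz => ?_)
  have := (hφ.2 _ _).1 hyz x hx
  rw [ha, ha] at this
  exact Subtype.ext (WithOne.coe_inj.1 this)

end SchutzenbergerGroup

universe u

theorem finitely_many_hclasses_completely_separable (S : Type u) [Semigroup S]
    (hfin : (Set.range fun x : S => HClass x).Finite) :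
    (IsCompletelySeparable S ↔
      (∀ (x : S) (Γ : Type u) (_ : Group Γ) (φ : SchStab (HClass x) →* Γ),
        IsSchutzenbergerGroup (HClass x) Γ φ → IsCompletelySeparable Γ)) ∧
    ((∀ (x : S) (Γ : Type u) (_ : Group Γ) (φ : SchStab (HClass x) →* Γ),
        IsSchutzenbergerGroup (HClass x) Γ φ → IsCompletelySeparable Γ) ↔ Finite S) := by
  have h13 : IsCompletelySeparable S → Finite S := fun h =>
    finite_of_finite_hClasses hfin h.finite_hClass
  have h32 : Finite S → ∀ (x : S) (Γ : Type u) (_ : Group Γ) (φ : SchStab (HClass x) →* Γ),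
      IsSchutzenbergerGroup (HClass x) Γ φ → IsCompletelySeparable Γ := by
    intro _ x Γ _ φ hφ
    have : Finite (WithOne S) := inferInstanceAs (Finite (Option S))
    have : Finite Γ := Finite.of_surjective φ hφ.1
    exact .of_finite
  have h23 : (∀ (x : S) (Γ : Type u) (_ : Group Γ) (φ : SchStab (HClass x) →* Γ),
      IsSchutzenbergerGroup (HClass x) Γ φ → IsCompletelySeparable Γ) → Finite S := by
    intro h
    refine finite_of_finite_hClasses hfin fun x => ?_
    let _ := schGroup x
    have := (h x _ _ _ (isSchutzenbergerGroup_mk' x)).finite_of_group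
    exact (isSchutzenbergerGroup_mk' x).finite_hClass
  have h31 : Finite S → IsCompletelySeparable S := fun _ => .of_finite
  exact ⟨⟨fun h => h32 (h13 h), fun h => h31 (h23 h)⟩, h23, h32⟩
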